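/- Let G be a finite group whose character graph Δ(G) is K₄-free and has exactly seven vertices, so that G ≅ PSL₂(2^f) × R(G) for some f ≥ 2. If 2^f − 1 and 2^f + 1 each have exactly two prime divisors, then ρ(R(G)) has exactly two elements, Δ(R(G)) is edgeless (hence disconnected), and Δ(G) is isomorphic to the join (K₂ ∪ K₁ ∪ K₂) ⋆ K₂ᶜ. -/

import Mathlib

open CategoryTheory

/-- `cd(G)`: the set of character degrees of `G`, i.e. the dimensions of the simple
finite-dimensional complex representations of `G`. -/
def charDegrees (G : Type) [Group G] : Set ℕ :=
  { n | ∃ V : FDRep ℂ G, Simple V ∧ Module.finrank ℂ V = n }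

/-- `ρ(G)`: the set of primes dividing some character degree of `G`. -/
def charPrimes (G : Type) [Group G] : Set ℕ :=
  { p | p.Prime ∧ ∃ n ∈ charDegrees G, p ∣ n }

/-- The character graph `Δ(G)`, on vertex set `ρ(G)`: two distinct primes `p`, `q`
are adjacent iff `p * q` divides some character degree of `G`. -/
def charGraph (G : Type) [Group G] : SimpleGraph (charPrimes G) where
  Adj p q := (p : ℕ) ≠ (q : ℕ) ∧ ∃ n ∈ charDegrees G, (p : ℕ) * (q : ℕ) ∣ n
  symm := by
    refine ⟨?_⟩
    rintro p q ⟨h, n, hn, hd⟩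
    exact ⟨fun e => h e.symm, n, hn, by rwa [mul_comm]⟩
  loopless := by refine ⟨?_⟩; rintro p ⟨h, -⟩; exact h rfl

/-- The solvable radical `R(G)` of `G`: the largest solvable normal subgroup of `G`
(realized as the join of all solvable normal subgroups). -/
def solvableRadical (G : Type*) [Group G] : Subgroup G :=
  ⨆ N : { N : Subgroup G // N.Normal ∧ IsSolvable ↥N }, (N : Subgroup G)

instance solvableRadical_normal (G : Type*) [Group G] : (solvableRadical G).Normal := by
  constructor
  intro n hn g
  refine Subgroup.iSup_induction (C := fun x => g * x * g⁻¹ ∈ solvableRadical G)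
    (fun N : { N : Subgroup G // N.Normal ∧ IsSolvable ↥N } => (N : Subgroup G)) hn ?_ ?_ ?_
  · intro N x hx
    exact Subgroup.mem_iSup_of_mem N (N.2.1.conj_mem x hx g)
  · simpa using Subgroup.one_mem _
  · intro x y hx hy
    have h : g * (x * y) * g⁻¹ = (g * x * g⁻¹) * (g * y * g⁻¹) := by group
    rw [h]; exact Subgroup.mul_mem _ hx hy

/-- `PSL₂(F)`: the special linear group `SL₂(F)` modulo its center. -/
abbrev PSL2 (F : Type) [Field F] :=
  Matrix.SpecialLinearGroup (Fin 2) F ⧸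
    Subgroup.center (Matrix.SpecialLinearGroup (Fin 2) F)

/-- The join `Γ ⋆ Δ` of two simple graphs: the disjoint union together with all
edges between the two vertex sets. -/
def graphJoin {α β : Type*} (G : SimpleGraph α) (H : SimpleGraph β) :
    SimpleGraph (α ⊕ β) :=
  (G ⊕g H) ⊔
    { Adj := fun u v => u.isLeft ≠ v.isLeft
      symm := ⟨fun _ _ h => h.symm⟩
      loopless := ⟨fun _ h => h rfl⟩ }

/-- The image of a subgroup `M` of `G` in `G/R(G)`; when `R(G) ≤ M` this is `M/R(G)`. -/
def radicalQuotImage {G : Type*} [Group G] (M : Subgroup G) :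
    Subgroup (G ⧸ solvableRadical G) :=
  M.map (QuotientGroup.mk' (solvableRadical G))


section CharDeg
open Representation

theorem isIrr_iff {G V : Type*} [Group G] [AddCommGroup V] [Module ℂ V]
    (ρ : Representation ℂ G V) :
    IsIrreducible ρ ↔ Nontrivial V ∧ ∀ W : Submodule ℂ V, (∀ g, ∀ v ∈ W, ρ g v ∈ W) →
      W = ⊥ ∨ W = ⊤ := by
  constructor
  · intro h
    refine ⟨?_, ?_⟩
    · by_contra hn
      rw [not_nontrivial_iff_subsingleton] at hn
      apply bot_ne_top (α := Subrepresentation ρ)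
      apply Subrepresentation.toSubmodule_injective
      exact Subsingleton.elim _ _
    · intro W hW
      rcases h.eq_bot_or_eq_top (⟨W, fun g v hv => hW g v hv⟩ : Subrepresentation ρ) with h | h
      · left; exact congrArg Subrepresentation.toSubmodule h
      · right; exact congrArg Subrepresentation.toSubmodule h
  · rintro ⟨h1, h2⟩
    refine { exists_pair_ne := ⟨⊥, ⊤, ?_⟩, eq_bot_or_eq_top := ?_ }
    · intro h
      exact bot_ne_top (α := Submodule ℂ V) (congrArg Subrepresentation.toSubmodule h)
    · intro W
      rcases h2 W.toSubmodule (fun g v hv => W.apply_mem_toSubmodule g hv) with h | h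
      · left; exact Subrepresentation.toSubmodule_injective h
      · right; exact Subrepresentation.toSubmodule_injective h

theorem char_of_eq {G : Type} [Group G] {V : Type} [AddCommGroup V] [Module ℂ V]
    [FiniteDimensional ℂ V] (ρ : Representation ℂ G V) :
    (FDRep.of ρ).character = ρ.character := rfl

theorem irr_norm {G : Type} [Group G] [Fintype G] {V : Type} [AddCommGroup V] [Module ℂ V]
    [FiniteDimensional ℂ V] (ρ : Representation ℂ G V) [IsIrreducible ρ] :
    ∑ g : G, ρ.character g * ρ.character g⁻¹ = Nat.card G := by
  have := invertibleOfNonzero (NeZero.ne (Nat.card G : ℂ))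
  have h := char_orthonormal ρ ρ
  rw [if_pos ⟨Representation.Equiv.refl ρ⟩] at h
  rw [inv_mul_eq_one₀ (NeZero.ne _)] at h
  exact h.symm

theorem simple_of_irr {G : Type} [Group G] [Finite G] {V : Type} [AddCommGroup V] [Module ℂ V]
    [FiniteDimensional ℂ V] (ρ : Representation ℂ G V) [IsIrreducible ρ] :
    Simple (FDRep.of ρ) := by
  have := Fintype.ofFinite G
  rw [FDRep.simple_iff_char_is_norm_one, char_of_eq]
  exact irr_norm ρ

theorem irr_of_simple {G : Type} [Group G] [Finite G] (V : FDRep ℂ G) [Simple V] :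
    IsIrreducible V.ρ := by
  have := Fintype.ofFinite G
  rw [isIrr_iff]
  constructor
  · by_contra hn
    rw [not_nontrivial_iff_subsingleton] at hn
    apply id_nonzero V
    ext x
    exact Subsingleton.elim _ _
  · intro W hW
    let σ : Subrepresentation V.ρ := ⟨W, fun g v hv => hW g v hv⟩
    let ι : FDRep.of σ.toRepresentation ⟶ V :=
      ⟨InducedCategory.homMk (ModuleCat.ofHom W.subtype), fun g => by
        ext x; rfl⟩
    have hinj : Function.Injective (W.subtype) := W.injective_subtype
    have hm : Mono ι := by
      refine ⟨fun {Z} a b hab => ?_⟩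
      ext x
      exact congrArg (fun (c : Z ⟶ V) => c.hom.hom.hom x) hab
    by_cases h0 : ι = 0
    · left
      rw [Submodule.eq_bot_iff]
      intro x hx
      exact congrArg (fun (c : FDRep.of σ.toRepresentation ⟶ V) => c.hom.hom.hom ⟨x, hx⟩) h0
    · right
      have := isIso_of_mono_of_nonzero h0
      rw [Submodule.eq_top_iff']
      intro x
      have h1 : inv ι ≫ ι = 𝟙 V := IsIso.inv_hom_id ι
      have h2 := congrArg (fun (c : V ⟶ V) => c.hom.hom.hom x) h1
      have h3 : W.subtype ((inv ι).hom.hom.hom x) = x := h2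
      rw [← h3]
      exact Submodule.coe_mem _

theorem mem_cd_iff {G : Type} [Group G] [Finite G] (n : ℕ) :
    n ∈ charDegrees G ↔ ∃ (V : Type) (_ : AddCommGroup V) (_ : Module ℂ V)
      (_ : FiniteDimensional ℂ V) (ρ : Representation ℂ G V), IsIrreducible ρ ∧
        Module.finrank ℂ V = n := by
  constructor
  · rintro ⟨V, hV, h⟩
    exact ⟨V, inferInstance, inferInstance, inferInstance, V.ρ, irr_of_simple V, h⟩
  · rintro ⟨V, _, _, _, ρ, h, hn⟩
    exact ⟨FDRep.of ρ, simple_of_irr ρ, hn⟩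

theorem irr_of_norm {G : Type} [Group G] [Fintype G] {V : Type} [AddCommGroup V] [Module ℂ V]
    [FiniteDimensional ℂ V] (ρ : Representation ℂ G V)
    (h : ∑ g : G, ρ.character g * ρ.character g⁻¹ = Nat.card G) : IsIrreducible ρ := by
  have : Simple (FDRep.of ρ) := by
    rw [FDRep.simple_iff_char_is_norm_one, char_of_eq]; exact h
  exact irr_of_simple (FDRep.of ρ)

theorem cd_mulEquiv_sub {G H : Type} [Group G] [Group H] [Finite G] [Finite H] (e : G ≃* H) :
    charDegrees H ⊆ charDegrees G := by
  intro n hn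
  rw [mem_cd_iff] at hn ⊢
  obtain ⟨V, _, _, _, ρ, h, hn⟩ := hn
  refine ⟨V, _, _, inferInstance, ρ.comp e.toMonoidHom, ?_, hn⟩
  rw [isIrr_iff] at h ⊢
  refine ⟨h.1, fun W hW => h.2 W fun g v hv => ?_⟩
  simpa using hW (e.symm g) v hv

theorem cd_mulEquiv {G H : Type} [Group G] [Group H] [Finite G] [Finite H] (e : G ≃* H) :
    charDegrees G = charDegrees H :=
  Set.Subset.antisymm (cd_mulEquiv_sub e.symm) (cd_mulEquiv_sub e)

theorem irr_tensor {S R : Type} [Group S] [Group R] [Finite S] [Finite R] {V W : Type}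
    [AddCommGroup V] [Module ℂ V] [FiniteDimensional ℂ V]
    [AddCommGroup W] [Module ℂ W] [FiniteDimensional ℂ W]
    (ρ : Representation ℂ S V) (σ : Representation ℂ R W) [IsIrreducible ρ] [IsIrreducible σ] :
    IsIrreducible (tprod (ρ.comp (MonoidHom.fst S R)) (σ.comp (MonoidHom.snd S R))) := by
  have := Fintype.ofFinite S
  have := Fintype.ofFinite R
  apply irr_of_norm
  rw [char_tensor, Fintype.sum_prod_type]
  have h1 := irr_norm ρ
  have h2 := irr_norm σ
  rw [Nat.card_prod, Nat.cast_mul, ← h1, ← h2, Finset.sum_mul_sum]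
  refine Finset.sum_congr rfl fun s _ => Finset.sum_congr rfl fun r _ => ?_
  have e1 : ∀ g : S × R, character (ρ.comp (MonoidHom.fst S R)) g = ρ.character g.1 :=
    fun g => rfl
  have e2 : ∀ g : S × R, character (σ.comp (MonoidHom.snd S R)) g = σ.character g.2 :=
    fun g => rfl
  simp only [Pi.mul_apply, e1, e2, Prod.fst_inv, Prod.snd_inv]
  ring

theorem exists_irr_sub {G V : Type*} [Group G] [AddCommGroup V] [Module ℂ V]
    [FiniteDimensional ℂ V] [Nontrivial V] (ρ : Representation ℂ G V) :
    ∃ σ : Subrepresentation ρ, IsIrreducible σ.toRepresentation := by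
  classical
  have hex : ∃ n, ∃ σ : Subrepresentation ρ, σ.toSubmodule ≠ ⊥ ∧
      Module.finrank ℂ σ.toSubmodule = n := ⟨_, ⊤, (top_ne_bot : (⊤ : Submodule ℂ V) ≠ ⊥), rfl⟩
  obtain ⟨σ, h0, hn⟩ := Nat.find_spec hex
  refine ⟨σ, ?_⟩
  rw [isIrr_iff]
  refine ⟨Submodule.nontrivial_iff_ne_bot.mpr h0, fun W hW => ?_⟩
  by_contra hcon
  push Not at hcon
  let τ : Subrepresentation ρ := ⟨W.map σ.toSubmodule.subtype, by
    rintro g _ ⟨x, hx, rfl⟩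
    exact ⟨_, hW g x hx, rfl⟩⟩
  have h1 : Module.finrank ℂ τ.toSubmodule = Module.finrank ℂ W :=
    LinearEquiv.finrank_eq (Submodule.equivMapOfInjective _ σ.toSubmodule.injective_subtype W).symm
  have h2 := Submodule.finrank_lt hcon.2
  refine Nat.find_min hex (m := Module.finrank ℂ W) (by rw [← hn]; exact h2) ⟨τ, ?_, h1⟩
  intro h3
  apply hcon.1
  apply Submodule.map_injective_of_injective σ.toSubmodule.injective_subtype
  rw [Submodule.map_bot]
  exact h3

theorem cd_prod_mul {S R : Type} [Group S] [Group R] [Finite S] [Finite R] {n m : ℕ}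
    (hn : n ∈ charDegrees S) (hm : m ∈ charDegrees R) : n * m ∈ charDegrees (S × R) := by
  rw [mem_cd_iff] at hn hm ⊢
  obtain ⟨V, _, _, _, ρ, h, rfl⟩ := hn
  obtain ⟨W, _, _, _, σ, h', rfl⟩ := hm
  exact ⟨TensorProduct ℂ V W, _, _, inferInstance, _, irr_tensor ρ σ, Module.finrank_tensorProduct⟩

/-- the space of `S`-equivariant maps -/
def homS {S R V : Type} [Group S] [Group R]
    [AddCommGroup V] [Module ℂ V] (ρ : Representation ℂ (S × R) V) (W : Submodule ℂ V) :
    Submodule ℂ (W →ₗ[ℂ] V) where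
  carrier := {h | ∀ s : S, ∀ w w' : W, (w' : V) = ρ (s, 1) w → h w' = ρ (s, 1) (h w)}
  add_mem' := by
    intro a b ha hb s w w' hw
    simp [ha s w w' hw, hb s w w' hw]
  zero_mem' := by intro s w w' hw; simp
  smul_mem' := by
    intro c a ha s w w' hw
    simp [ha s w w' hw]

/-- the action of `R` on the space of `S`-equivariant maps -/
def homSRep {S R V : Type} [Group S] [Group R]
    [AddCommGroup V] [Module ℂ V] (ρ : Representation ℂ (S × R) V) (W : Submodule ℂ V) :
    Representation ℂ R (homS ρ W) where
  toFun r := 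
    { toFun := fun h => ⟨(ρ (1, r)).comp h.1, by
        intro s w w' hw
        simp only [LinearMap.comp_apply]
        rw [h.2 s w w' hw, ← Module.End.mul_apply, ← Module.End.mul_apply, ← map_mul, ← map_mul]
        simp⟩
      map_add' := by intro a b; ext; simp
      map_smul' := by intro a b; ext; simp }
  map_one' := by
    ext h w
    change ρ 1 (h.1 w) = h.1 w
    rw [map_one]; rfl
  map_mul' := by
    intro r r'
    ext h w
    have : ((1 : S), r * r') = (1, r) * (1, r') := by simp
    change ρ (1, r * r') (h.1 w) = ρ (1, r) (ρ (1, r') (h.1 w))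
    rw [this, map_mul]; rfl

theorem cd_prod_of_mem {S R : Type} [Group S] [Group R] [Finite S] [Finite R] {d : ℕ}
    (hd : d ∈ charDegrees (S × R)) :
    ∃ n ∈ charDegrees S, ∃ m ∈ charDegrees R, d = n * m := by
  rw [mem_cd_iff] at hd
  obtain ⟨V, _, _, _, ρ, h, rfl⟩ := hd
  have hV := ((isIrr_iff ρ).mp h).1
  obtain ⟨W, hW⟩ := exists_irr_sub (MonoidHom.comp ρ (MonoidHom.inl S R) : Representation ℂ S V)
  have hne : Nontrivial (homS ρ W.toSubmodule) := by
    have hWn := ((isIrr_iff _).mp hW).1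
    refine ⟨⟨⟨W.toSubmodule.subtype, ?_⟩, 0, ?_⟩⟩
    · intro s w w' hw; exact hw
    · intro h0
      obtain ⟨w, hw⟩ := exists_ne (0 : W.toSubmodule)
      apply hw
      have := congrArg (fun t => t.1 w) h0
      exact Subtype.ext this
  obtain ⟨U, hU⟩ := exists_irr_sub (homSRep ρ W.toSubmodule)
  have hT := irr_tensor (W := U.toSubmodule) W.toRepresentation U.toRepresentation
  let φ : TensorProduct ℂ W.toSubmodule U.toSubmodule →ₗ[ℂ] V :=
    TensorProduct.lift (LinearMap.flip
      ((homS ρ W.toSubmodule).subtype.comp U.toSubmodule.subtype))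
  have hφ : ∀ w u, φ (w ⊗ₜ u) = u.1.1 w := fun w u => rfl
  let Φ : IntertwiningMap (tprod (W.toRepresentation.comp (MonoidHom.fst S R))
      (U.toRepresentation.comp (MonoidHom.snd S R))) ρ := ⟨φ, by
    rintro ⟨s, r⟩
    apply TensorProduct.ext'
    intro w u
    have e1 : (s, r) = (1, r) * ((s, 1) : S × R) := by simp
    have := u.1.2 s w (W.toRepresentation s w) rfl
    change φ (W.toRepresentation s w ⊗ₜ U.toRepresentation r u) = ρ (s, r) (φ (w ⊗ₜ u))
    rw [hφ, hφ, e1, map_mul]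
    change ρ (1, r) (u.1.1 (W.toRepresentation s w)) = _
    rw [this]
    rfl⟩
  rcases IsIrreducible.bijective_or_eq_zero Φ with hb | h0
  · refine ⟨_, (mem_cd_iff _).mpr ⟨W.toSubmodule, _, _, inferInstance, _, hW, rfl⟩,
      _, (mem_cd_iff _).mpr ⟨U.toSubmodule, _, _, inferInstance, _, hU, rfl⟩, ?_⟩
    have hfree : Module.Free ℂ U.toSubmodule := Module.Free.of_divisionRing ℂ U.toSubmodule
    rw [← Module.finrank_tensorProduct]
    exact (LinearEquiv.finrank_eq (LinearEquiv.ofBijective φ hb)).symm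
  · exfalso
    have hUn := ((isIrr_iff _).mp hU).1
    obtain ⟨u, hu⟩ := exists_ne (0 : U.toSubmodule)
    apply hu
    ext w
    have h1 : Φ (w ⊗ₜ u) = 0 := by rw [h0]; rfl
    exact h1

end CharDeg

section Regular
open Representation

theorem trace_pi_matrix {n : ℕ} (d : Fin n → ℕ) (A : Π i, Matrix (Fin (d i)) (Fin (d i)) ℂ) :
    LinearMap.trace ℂ _ (LinearMap.mulLeft ℂ A) = ∑ i, (d i : ℂ) * (A i).trace := by
  classical
  rw [LinearMap.trace_eq_matrix_trace ℂ (Pi.basis fun i => Matrix.stdBasis ℂ (Fin (d i)) (Fin (d i)))]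
  rw [Matrix.trace, Fintype.sum_sigma]
  refine Finset.sum_congr rfl fun i _ => ?_
  rw [Fintype.sum_prod_type]
  have : ∀ a b, (LinearMap.toMatrix (Pi.basis fun i => Matrix.stdBasis ℂ (Fin (d i)) (Fin (d i)))
      (Pi.basis fun i => Matrix.stdBasis ℂ (Fin (d i)) (Fin (d i))) (LinearMap.mulLeft ℂ A)).diag
      ⟨i, (a, b)⟩ = A i a a := by
    intro a b
    rw [Matrix.diag_apply, LinearMap.toMatrix_apply, Pi.basis_repr, Pi.basis_apply]
    simp only [LinearMap.mulLeft_apply, Pi.mul_apply, Pi.single_eq_same]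
    rw [Matrix.stdBasis_eq_single]
    have h2 : ∀ M : Matrix (Fin (d i)) (Fin (d i)) ℂ,
        (Matrix.stdBasis ℂ (Fin (d i)) (Fin (d i))).repr M (a, b) = M a b := by
      intro M
      simp [Matrix.stdBasis]
    rw [h2]
    simp
  simp only [this]
  simp [Matrix.trace, Finset.mul_sum]

theorem trace_monoidAlgebra {G : Type} [Group G] [Fintype G] [DecidableEq G] (g : G) :
    LinearMap.trace ℂ _ (LinearMap.mulLeft ℂ (MonoidAlgebra.single g (1 : ℂ))) =
      if g = 1 then (Nat.card G : ℂ) else 0 := by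
  classical
  rw [LinearMap.trace_eq_matrix_trace ℂ (MonoidAlgebra.basis G ℂ), Matrix.trace]
  have : ∀ h : G, (LinearMap.toMatrix (MonoidAlgebra.basis G ℂ) (MonoidAlgebra.basis G ℂ)
      (LinearMap.mulLeft ℂ (MonoidAlgebra.single g (1 : ℂ)))).diag h = if g = 1 then 1 else 0 := by
    intro h
    rw [Matrix.diag_apply, LinearMap.toMatrix_apply, MonoidAlgebra.basis_apply,
      LinearMap.mulLeft_apply, MonoidAlgebra.single_mul_single, mul_one,
      ← MonoidAlgebra.basis_apply, Module.Basis.repr_self, Finsupp.single_apply]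
    simp
  simp only [this]
  split_ifs <;> simp

theorem exists_regular (G : Type) [Group G] [Finite G] :
    ∃ (n : ℕ) (d : Fin n → ℕ) (ρ : ∀ i, Representation ℂ G (Fin (d i) → ℂ)),
      (∀ i, IsIrreducible (ρ i)) ∧
      ∀ K : Subgroup G, (Nat.card K) * ∑ i, d i *
        Module.finrank ℂ (invariants ((ρ i).comp K.subtype : Representation ℂ K _)) = Nat.card G := by
  classical
  have := Fintype.ofFinite G
  obtain ⟨n, d, hd, ⟨e⟩⟩ :=
    IsSemisimpleRing.exists_algEquiv_pi_matrix_of_isAlgClosed ℂ (MonoidAlgebra ℂ G)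
  let ρ : ∀ i, Representation ℂ G (Fin (d i) → ℂ) := fun i =>
    { toFun := fun g => Matrix.toLin' (e (MonoidAlgebra.single g 1) i)
      map_one' := by
        rw [← MonoidAlgebra.one_def, map_one]
        exact Matrix.toLin'_one
      map_mul' := by
        intro g h
        rw [Module.End.mul_eq_comp, ← Matrix.toLin'_mul, ← Pi.mul_apply, ← map_mul,
          MonoidAlgebra.single_mul_single, mul_one] }
  have hρ : ∀ i g, ρ i g = Matrix.toLin' (e (MonoidAlgebra.single g 1) i) := fun _ _ => rfl
  refine ⟨n, d, ρ, ?_, ?_⟩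
  · intro i
    rw [isIrr_iff]
    refine ⟨inferInstance, fun W hW => ?_⟩
    have h1 : ∀ a : MonoidAlgebra ℂ G, ∀ v ∈ W, (e a i).mulVec v ∈ W := by
      intro a v hv
      induction a using MonoidAlgebra.induction_linear with
      | zero => simp
      | add x y hx hy =>
        rw [map_add, Pi.add_apply, Matrix.add_mulVec]
        exact W.add_mem hx hy
      | single g c =>
        have : MonoidAlgebra.single g c = c • MonoidAlgebra.single g (1 : ℂ) := by
          simp
        rw [this, map_smul, Pi.smul_apply, Matrix.smul_mulVec]
        exact W.smul_mem _ (hW g v hv)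
    by_cases h0 : W = ⊥
    · left; exact h0
    right
    obtain ⟨w, hw, hw0⟩ := W.ne_bot_iff.mp h0
    obtain ⟨a, ha⟩ := Function.ne_iff.mp hw0
    rw [Submodule.eq_top_iff']
    intro v
    obtain ⟨x, hx⟩ := e.surjective (Pi.single i (Matrix.vecMulVec v (Pi.single a (w a)⁻¹)))
    have := h1 x w hw
    rw [hx, Pi.single_eq_same, Matrix.vecMulVec_mulVec] at this
    simpa [inv_mul_cancel₀ ha] using this
  · intro K
    have hchar : ∀ g, ∑ i, (d i : ℂ) * (ρ i).character g = if g = 1 then (Nat.card G : ℂ) else 0 := by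
      intro g
      rw [← trace_monoidAlgebra, ← LinearMap.trace_conj' _ e.toLinearEquiv]
      have : e.toLinearEquiv.conj (LinearMap.mulLeft ℂ (MonoidAlgebra.single g (1 : ℂ))) =
          LinearMap.mulLeft ℂ (e (MonoidAlgebra.single g 1)) := by
        refine LinearMap.ext fun x => ?_
        change e (MonoidAlgebra.single g (1 : ℂ) * e.symm x) = e (MonoidAlgebra.single g 1) * x
        rw [map_mul, AlgEquiv.apply_symm_apply]
      rw [this, trace_pi_matrix]
      refine Finset.sum_congr rfl fun i _ => ?_
      rw [character, hρ, Matrix.trace_toLin'_eq]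
    have hinv := invertibleOfNonzero (NeZero.ne (Nat.card K : ℂ))
    have hK : ∀ i, (Module.finrank ℂ (invariants ((ρ i).comp K.subtype : Representation ℂ K _)) : ℂ) =
        (Nat.card K : ℂ)⁻¹ * ∑ k : K, (ρ i).character k := by
      intro i
      rw [← card_inv_mul_sum_char_eq_finrank]
      rfl
    have : (Nat.card K : ℂ) * ∑ i, (d i : ℂ) *
        (Module.finrank ℂ (invariants ((ρ i).comp K.subtype : Representation ℂ K _)) : ℂ)
          = Nat.card G := by
      simp only [hK]
      rw [Finset.mul_sum]
      have h2 : ∀ i, (Nat.card K : ℂ) * ((d i : ℂ) * ((Nat.card K : ℂ)⁻¹ * ∑ k : K, (ρ i).character k))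
          = ∑ k : K, (d i : ℂ) * (ρ i).character k := by
        intro i
        rw [← Finset.mul_sum]
        field_simp
      simp only [h2]
      rw [Finset.sum_comm]
      simp only [hchar]
      simp
    exact_mod_cast this

end Regular

section SLtwo
open Representation Matrix

/-- a shorthand for the special linear group -/
abbrev SLt (F : Type) [Field F] := Matrix.SpecialLinearGroup (Fin 2) F

variable {F : Type} [Field F]

/-- element of SL2 with given entries -/
def mk4 (a b c d : F) (h : a * d - b * c = 1) : SLt F :=
  ⟨!![a, b; c, d], by rw [Matrix.det_fin_two_of]; exact h⟩

theorem mk4_mul (a b c d : F) (h) (a' b' c' d' : F) (h') :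
    mk4 a b c d h * mk4 a' b' c' d' h' =
      mk4 (a * a' + b * c') (a * b' + b * d') (c * a' + d * c') (c * b' + d * d')
        (by linear_combination (a' * d' - b' * c') * h + h') := by
  apply Subtype.ext
  change !![a, b; c, d] * !![a', b'; c', d'] = _
  rw [Matrix.mul_fin_two]
  rfl

theorem mk4_surj (g : SLt F) : ∃ a b c d h, g = mk4 a b c d h := by
  refine ⟨g.1 0 0, g.1 0 1, g.1 1 0, g.1 1 1, ?_, ?_⟩
  · rw [← Matrix.det_fin_two]; exact g.2
  · apply Subtype.ext
    exact Matrix.eta_fin_two g.1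

theorem mk4_inj {a b c d : F} {h} {a' b' c' d' : F} {h'} (ha : a = a') (hb : b = b') (hc : c = c')
    (hd : d = d') : mk4 a b c d h = mk4 a' b' c' d' h' := by
  subst ha hb hc hd; rfl

theorem mk4_eq {a b c d : F} {h} {a' b' c' d' : F} {h'} (e : mk4 a b c d h = mk4 a' b' c' d' h') :
    a = a' ∧ b = b' ∧ c = c' ∧ d = d' := by
  have e' : !![a, b; c, d] = !![a', b'; c', d'] := congrArg Subtype.val e
  have h00 := congrFun (congrFun e' 0) 0
  have h01 := congrFun (congrFun e' 0) 1
  have h10 := congrFun (congrFun e' 1) 0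
  have h11 := congrFun (congrFun e' 1) 1
  simp at h00 h01 h10 h11
  exact ⟨h00, h01, h10, h11⟩

theorem mk4_one : mk4 (1 : F) 0 0 1 (by ring) = 1 := by
  apply Subtype.ext
  exact Matrix.one_fin_two.symm

/-- unipotent elements -/
def uu (x : F) : SLt F := mk4 1 x 0 1 (by ring)

theorem uu_mul (x y : F) : uu x * uu y = uu (x + y) := by
  unfold uu; rw [mk4_mul]; apply mk4_inj <;> ring

theorem uu_zero : uu (0 : F) = 1 := mk4_one

theorem uu_inj : Function.Injective (uu : F → SLt F) := fun _ _ h => (mk4_eq h).2.1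

/-- torus elements -/
def tt (a : Fˣ) : SLt F := mk4 a 0 0 (a⁻¹ : Fˣ) (by simp)

theorem tt_uu (a : Fˣ) (x : F) : tt a * uu x = uu (a ^ 2 * x) * tt a := by
  unfold tt uu; rw [mk4_mul, mk4_mul]; apply mk4_inj <;> simp
  field_simp

theorem tt_mul (a b : Fˣ) : tt a * tt b = tt (a * b) := by
  unfold tt; rw [mk4_mul]; apply mk4_inj <;> simp [mul_comm]

theorem tt_one : tt (1 : Fˣ) = 1 := by
  rw [← mk4_one]; unfold tt; apply mk4_inj <;> simp

/-- the Weyl element -/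
def ww : SLt F := mk4 0 1 (-1) 0 (by ring)

/-- the unipotent subgroup -/
def UU (F : Type) [Field F] : Subgroup (SLt F) where
  carrier := Set.range uu
  mul_mem' := by rintro _ _ ⟨x, rfl⟩ ⟨y, rfl⟩; exact ⟨x + y, (uu_mul x y).symm⟩
  one_mem' := ⟨0, uu_zero⟩
  inv_mem' := by
    rintro _ ⟨x, rfl⟩
    refine ⟨-x, ?_⟩
    rw [eq_inv_iff_mul_eq_one, uu_mul, neg_add_cancel, uu_zero]

/-- parametrization of the unipotent subgroup -/
noncomputable def UUequiv (F : Type) [Field F] : F ≃ UU F :=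
  Equiv.ofInjective uu uu_inj

/-- the unipotents normally generate -/
theorem normal_top (N : Subgroup (SLt F)) [hN : N.Normal] (h : ∀ x, uu x ∈ N) : N = ⊤ := by
  have hl : ∀ x : F, mk4 1 0 x 1 (by ring) ∈ N := by
    intro x
    have h1 := hN.conj_mem _ (h (-x)) ww
    have h2 : (ww : SLt F) * uu (-x) * ww⁻¹ = mk4 1 0 x 1 (by ring) := by
      rw [mul_inv_eq_iff_eq_mul]
      unfold ww uu; rw [mk4_mul, mk4_mul]; apply mk4_inj <;> ring
    rwa [h2] at h1
  have hg : ∀ a b c d h, c ≠ 0 → mk4 (F := F) a b c d h ∈ N := by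
    intro a b c d hd hc
    have h2 : mk4 a b c d hd = uu ((a - 1) / c) * mk4 1 0 c 1 (by ring) * uu ((d - 1) / c) := by
      unfold uu; rw [mk4_mul, mk4_mul]
      apply mk4_inj <;> field_simp
      · ring
      · linear_combination -hd
      · ring
      · ring
    rw [h2]
    exact N.mul_mem (N.mul_mem (h _) (hl _)) (h _)
  rw [Subgroup.eq_top_iff']
  intro g
  obtain ⟨a, b, c, d, hd, rfl⟩ := mk4_surj g
  by_cases hc : c = 0
  · subst hc
    have h2 : mk4 a b 0 d hd = mk4 (a - b) b (-d) d (by linear_combination hd) * mk4 1 0 1 1 (by ring) := by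
      rw [mk4_mul]; apply mk4_inj <;> ring
    rw [h2]
    refine N.mul_mem (hg _ _ _ _ _ ?_) (hl 1)
    intro h0
    simp at h0
    simp [h0] at hd
  · exact hg _ _ _ _ _ hc

theorem card_SLt (F : Type) [Field F] [Fintype F] [DecidableEq F] :
    Nat.card (SLt F) = Fintype.card F * (Fintype.card F - 1) * (Fintype.card F + 1) := by
  let e : SLt F ≃ (Fˣ × F × F) ⊕ (Fˣ × F) :=
  { toFun := fun g => if h : g.1 1 0 = 0 then
        Sum.inr (Units.mk0 (g.1 0 0) (by
          intro h0
          have := g.2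
          rw [Matrix.det_fin_two, h, h0] at this
          simp at this), g.1 0 1)
      else Sum.inl (Units.mk0 (g.1 1 0) h, g.1 0 0, g.1 1 1)
    invFun := fun s => match s with
      | Sum.inl (c, a, d) => mk4 a ((a * d - 1) / c) c d (by field_simp; ring)
      | Sum.inr (a, b) => mk4 a b 0 (a⁻¹ : Fˣ) (by simp)
    left_inv := by
      intro g
      obtain ⟨a, b, c, d, h, rfl⟩ := mk4_surj g
      by_cases hc : c = 0
      · subst hc
        have ha : a ≠ 0 := by rintro rfl; simp at h
        have hd : d = a⁻¹ := by
          field_simp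
          linear_combination h
        subst hd
        simp [mk4]
        rfl
      · have hb : b = (a * d - 1) / c := by
          field_simp
          linear_combination -h
        subst hb
        simp [mk4, hc]
        rfl
    right_inv := by
      rintro (⟨c, a, d⟩ | ⟨a, b⟩)
      · simp [mk4]
      · simp [mk4] }
  have hc := Fintype.card_pos (α := F)
  rw [Nat.card_congr e, Nat.card_sum, Nat.card_prod, Nat.card_prod, Nat.card_prod, 
    Nat.card_eq_fintype_card, Nat.card_eq_fintype_card, Fintype.card_units]
  ring

end SLtwo

section SLrep
open Representation Matrix

variable {F : Type} [Field F] [Fintype F]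
variable {V : Type} [AddCommGroup V] [Module ℂ V]

/-- projection to the eigenspace of a character of the unipotent group -/
noncomputable def PP (ρ : Representation ℂ (SLt F) V) (ψ : AddChar F ℂ) (a : F) : V →ₗ[ℂ] V :=
  (Fintype.card F : ℂ)⁻¹ • ∑ x : F, ψ (-(x * a)) • ρ (uu x)

theorem PP_apply (ρ : Representation ℂ (SLt F) V) (ψ : AddChar F ℂ) (a : F) (v : V) :
    PP ρ ψ a v = (Fintype.card F : ℂ)⁻¹ • ∑ x : F, ψ (-(x * a)) • ρ (uu x) v := by
  simp [PP]

theorem rho_mul {F : Type} [Field F] (ρ : Representation ℂ (SLt F) V) (g h : SLt F) (v : V) :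
    ρ (g * h) v = ρ g (ρ h v) := by rw [map_mul]; rfl

theorem PP_uu (ρ : Representation ℂ (SLt F) V) (ψ : AddChar F ℂ) (a y : F) (v : V) :
    PP ρ ψ a (ρ (uu y) v) = ψ (y * a) • PP ρ ψ a v := by
  rw [PP_apply, PP_apply, smul_comm]
  congr 1
  rw [Finset.smul_sum]
  refine Fintype.sum_equiv (Equiv.addRight y) _ _ fun x => ?_
  rw [Equiv.coe_addRight, smul_smul, ← AddChar.map_add_eq_mul, ← rho_mul, uu_mul]
  congr 2
  ring

theorem uu_PP (ρ : Representation ℂ (SLt F) V) (ψ : AddChar F ℂ) (a y : F) (v : V) :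
    ρ (uu y) (PP ρ ψ a v) = ψ (y * a) • PP ρ ψ a v := by
  rw [PP_apply, map_smul, smul_comm, map_sum]
  congr 1
  rw [Finset.smul_sum]
  refine Fintype.sum_equiv (Equiv.addRight y) _ _ fun x => ?_
  rw [Equiv.coe_addRight, smul_smul, ← AddChar.map_add_eq_mul, map_smul, ← rho_mul, uu_mul]
  congr 2
  · ring
  · rw [add_comm]

theorem PP_idem (ρ : Representation ℂ (SLt F) V) (ψ : AddChar F ℂ) (a : F) (v : V) :
    PP ρ ψ a (PP ρ ψ a v) = PP ρ ψ a v := by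
  conv_lhs => rw [PP_apply]
  simp only [uu_PP, smul_smul, ← AddChar.map_add_eq_mul]
  simp only [neg_add_cancel, AddChar.map_zero_eq_one, one_smul, Finset.sum_const, Finset.card_univ]
  rw [← Nat.cast_smul_eq_nsmul ℂ, smul_smul, inv_mul_cancel₀, one_smul]
  exact Nat.cast_ne_zero.mpr Fintype.card_ne_zero

theorem PP_sum (ρ : Representation ℂ (SLt F) V) (ψ : AddChar F ℂ) (hψ : ψ.IsPrimitive) :
    ∑ a, PP ρ ψ a = 1 := by
  classical
  unfold PP
  rw [← Finset.smul_sum, Finset.sum_comm]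
  simp only [← Finset.sum_smul]
  have : ∀ x : F, ∑ a, ψ (-(x * a)) = if x = 0 then (Fintype.card F : ℂ) else 0 := by
    intro x
    have := AddChar.sum_mulShift (-x) hψ
    simp only [neg_eq_zero] at this
    rw [← Nat.cast_zero (R := ℂ), ← Nat.cast_ite, ← this]
    refine Finset.sum_congr rfl fun a _ => ?_
    congr 1; ring
  simp only [this, ite_smul, zero_smul, Finset.sum_ite_eq', Finset.mem_univ, if_true]
  rw [uu_zero, map_one, smul_smul, inv_mul_cancel₀, one_smul]
  exact Nat.cast_ne_zero.mpr Fintype.card_ne_zero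

theorem tt_PP (ρ : Representation ℂ (SLt F) V) (ψ : AddChar F ℂ) (c : Fˣ) (a : F) :
    ρ (tt c) * PP ρ ψ (c ^ 2 * a) = PP ρ ψ a * ρ (tt c) := by
  refine LinearMap.ext fun v => ?_
  rw [Module.End.mul_apply, Module.End.mul_apply, PP_apply, PP_apply, map_smul, map_sum]
  congr 1
  refine Fintype.sum_equiv (Units.mulLeft (c ^ 2)) _ _ fun x => ?_
  rw [map_smul, ← rho_mul, ← rho_mul, tt_uu]
  simp only [Units.mulLeft_apply, Units.val_pow_eq_pow_val]
  congr 2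
  ring

theorem trace_PP [CharP F 2] (ρ : Representation ℂ (SLt F) V) (ψ : AddChar F ℂ) (a : F)
    (ha : a ≠ 0) : LinearMap.trace ℂ V (PP ρ ψ a) = LinearMap.trace ℂ V (PP ρ ψ 1) := by
  obtain ⟨c, hc⟩ : ∃ c : F, c ^ 2 = a := by
    have := FiniteField.isSquare_of_char_two (F := F) (ringChar.eq F 2) a
    obtain ⟨c, hc⟩ := this
    exact ⟨c, by rw [hc]; ring⟩
  have hc0 : c ≠ 0 := by rintro rfl; simp at hc; exact ha hc.symm
  have h := tt_PP ρ ψ (Units.mk0 c hc0) 1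
  rw [Units.val_mk0, hc, mul_one] at h
  have h2 : PP ρ ψ a = ρ (tt (Units.mk0 c hc0))⁻¹ * (PP ρ ψ 1 * ρ (tt (Units.mk0 c hc0))) := by
    rw [← h, ← mul_assoc, ← map_mul, inv_mul_cancel, map_one, one_mul]
  rw [h2, LinearMap.trace_mul_comm, mul_assoc, ← map_mul, mul_inv_cancel, map_one, mul_one]

/-- Gelfand trick: invariance under the anti-involution -/
theorem gelf_inv [CharP F 2] (ρ : Representation ℂ (SLt F) V) (ψ : AddChar F ℂ)
    (hψ : ψ.IsPrimitive) (a b c d : F) (h : a * d - b * c = 1) (h' : d * a - b * c = 1) (v : V) :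
    PP ρ ψ 1 (ρ (mk4 a b c d h) (PP ρ ψ 1 v)) = PP ρ ψ 1 (ρ (mk4 d b c a h') (PP ρ ψ 1 v)) := by
  by_cases hc : c = 0
  · subst hc
    have key : ∀ a b d : F, ∀ h : a * d - b * 0 = 1, a ≠ 1 →
        PP ρ ψ 1 (ρ (mk4 a b 0 d h) (PP ρ ψ 1 v)) = 0 := by
      intro a b d h ha
      by_contra hne
      have hd : d ≠ 0 := by rintro rfl; simp at h
      have hcom : ∀ x, uu x * mk4 a b 0 d h = mk4 a b 0 d h * uu (d ^ 2 * x) := by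
        intro x
        unfold uu; rw [mk4_mul, mk4_mul]; apply mk4_inj
        · ring
        · linear_combination (-d * x) * h
        · ring
        · ring
      have h1 : ∀ x, ψ (x * 1) = ψ (d ^ 2 * x * 1) := by
        intro x
        have e1 := PP_uu ρ ψ 1 x (ρ (mk4 a b 0 d h) (PP ρ ψ 1 v))
        rw [← rho_mul, hcom, rho_mul, uu_PP, map_smul, map_smul] at e1
        exact (smul_left_injective ℂ hne e1).symm
      have h2 : d ^ 2 - 1 ≠ 0 := by
        intro h0
        have h3 : (d - 1) ^ 2 = 0 := by
          have : (2 : F) = 0 := CharTwo.two_eq_zero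
          linear_combination h0 - (d - 1) * this
        have h4 : d = 1 := by
          have := pow_eq_zero_iff (two_ne_zero) |>.mp h3
          linear_combination this
        subst h4
        apply ha
        linear_combination h
      apply hψ h2
      ext x
      rw [AddChar.mulShift_apply, AddChar.one_apply, sub_mul, one_mul, AddChar.map_sub_eq_div,
        ← mul_one (d ^ 2 * x), ← h1, mul_one, div_self]
      exact (ψ.val_isUnit x).ne_zero
    by_cases ha : a = 1
    · subst ha
      have : d = 1 := by linear_combination h
      subst this
      rfl
    · have hd : d ≠ 1 := by
        rintro rfl
        apply ha
        linear_combination h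
      rw [key _ _ _ _ ha, key _ _ _ _ hd]
  · have e : mk4 d b c a h' = uu ((d - a) / c) * mk4 a b c d h * uu (-((d - a) / c)) := by
      unfold uu; rw [mk4_mul, mk4_mul]; apply mk4_inj <;> field_simp <;> ring
    rw [e, rho_mul, rho_mul, PP_uu, uu_PP, map_smul, map_smul, smul_smul, ← AddChar.map_add_eq_mul]
    simp

theorem PP_mid (ρ : Representation ℂ (SLt F) V) (ψ : AddChar F ℂ) (g h : SLt F) (v : V) :
    PP ρ ψ 1 (ρ g (PP ρ ψ 1 (ρ h (PP ρ ψ 1 v)))) = (Fintype.card F : ℂ)⁻¹ •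
      ∑ x : F, ψ (-(x * 1)) • PP ρ ψ 1 (ρ (g * uu x * h) (PP ρ ψ 1 v)) := by
  rw [PP_apply _ _ _ (ρ h _)]
  simp only [map_smul, map_sum, rho_mul]

theorem PP_comm [CharP F 2] (ρ : Representation ℂ (SLt F) V) (ψ : AddChar F ℂ)
    (hψ : ψ.IsPrimitive) (g h : SLt F) (v : V) :
    PP ρ ψ 1 (ρ g (PP ρ ψ 1 (ρ h (PP ρ ψ 1 v)))) = PP ρ ψ 1 (ρ h (PP ρ ψ 1 (ρ g (PP ρ ψ 1 v)))) := by
  obtain ⟨a, b, c, d, hd, rfl⟩ := mk4_surj g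
  obtain ⟨a', b', c', d', hd', rfl⟩ := mk4_surj h
  have e1 : PP ρ ψ 1 (ρ (mk4 a b c d hd) (PP ρ ψ 1 (ρ (mk4 a' b' c' d' hd') (PP ρ ψ 1 v)))) = 
      PP ρ ψ 1 (ρ (mk4 d' b' c' a' (by linear_combination hd'))
        (PP ρ ψ 1 (ρ (mk4 d b c a (by linear_combination hd)) (PP ρ ψ 1 v)))) := by
    rw [PP_mid, PP_mid]
    congr 1
    refine Finset.sum_congr rfl fun x _ => ?_
    congr 1
    unfold uu
    simp only [mk4_mul]
    rw [gelf_inv ρ ψ hψ _ _ _ _ _ (by linear_combination (a' * d' - b' * c') * hd + hd')]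
    congr 2
    apply congrArg
    apply mk4_inj <;> ring
  rw [e1, ← gelf_inv ρ ψ hψ a b c d hd,
    ← PP_idem ρ ψ 1 (ρ (mk4 a b c d hd) (PP ρ ψ 1 v)),
    ← gelf_inv ρ ψ hψ a' b' c' d' hd', PP_idem]

end SLrep

section SLdim
open Representation Matrix

variable {F : Type} [Field F] [Fintype F]
variable {V : Type} [AddCommGroup V] [Module ℂ V] [FiniteDimensional ℂ V]

theorem span_orbit {G V : Type*} [Group G] [AddCommGroup V] [Module ℂ V]
    (ρ : Representation ℂ G V) [h : IsIrreducible ρ] (v : V) (hv : v ≠ 0) :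
    Submodule.span ℂ (Set.range fun g => ρ g v) = ⊤ := by
  have hinv : ∀ g, ∀ w ∈ Submodule.span ℂ (Set.range fun g => ρ g v),
      ρ g w ∈ Submodule.span ℂ (Set.range fun g => ρ g v) := by
    intro g w hw
    induction hw using Submodule.span_induction with
    | mem x hx =>
      obtain ⟨k, rfl⟩ := hx
      refine Submodule.subset_span ⟨g * k, ?_⟩
      simp
    | zero => simp
    | add x y _ _ hx hy => rw [map_add]; exact Submodule.add_mem _ hx hy
    | smul c x _ hx => rw [map_smul]; exact Submodule.smul_mem _ _ hx
  rcases ((isIrr_iff ρ).mp h).2 (Submodule.span ℂ (Set.range fun g => ρ g v)) hinv with h | h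
  · exfalso
    apply hv
    have : v ∈ Submodule.span ℂ (Set.range fun g => ρ g v) :=
      Submodule.subset_span ⟨1, by simp⟩
    rw [h] at this
    exact (Submodule.mem_bot ℂ).mp this
  · exact h

/-- multiplicity one -/
theorem rank_PP [CharP F 2] (ρ : Representation ℂ (SLt F) V) [IsIrreducible ρ] (ψ : AddChar F ℂ)
    (hψ : ψ.IsPrimitive) : Module.finrank ℂ (LinearMap.range (PP ρ ψ 1)) ≤ 1 := by
  set P := PP ρ ψ 1 with hP
  -- cyclicity
  have hcyc : ∀ v, P v ≠ 0 → ∀ E : Submodule ℂ V, (∀ g, P (ρ g (P v)) ∈ E) → LinearMap.range P ≤ E := by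
    rintro v hv E hE _ ⟨w, rfl⟩
    have hw : w ∈ Submodule.span ℂ (Set.range fun g => ρ g (P v)) := by
      rw [span_orbit ρ _ hv]; trivial
    induction hw using Submodule.span_induction with
    | mem x hx =>
      obtain ⟨k, rfl⟩ := hx
      exact hE k
    | zero => simp
    | add x y _ _ hx hy => rw [map_add]; exact Submodule.add_mem _ hx hy
    | smul c x _ hx => rw [map_smul]; exact Submodule.smul_mem _ _ hx
  by_cases h0 : Nontrivial (LinearMap.range P)
  swap
  · rw [not_nontrivial_iff_subsingleton] at h0
    rw [Module.finrank_zero_of_subsingleton]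
    exact zero_le_one
  have hscal : ∀ g, ∃ c : ℂ, ∀ v, P (ρ g (P v)) = c • P v := by
    intro g
    let T : Module.End ℂ (LinearMap.range P) :=
      (P.comp (ρ g)).restrict (p := LinearMap.range P) (q := LinearMap.range P)
        (fun x _ => ⟨ρ g x, rfl⟩)
    obtain ⟨c, hc⟩ := Module.End.exists_eigenvalue T
    obtain ⟨⟨x, hx⟩, hev⟩ := hc.exists_hasEigenvector
    obtain ⟨y, rfl⟩ := hx
    have hy0 : P y ≠ 0 := fun h => hev.2 (Subtype.ext h)
    have hy : P (ρ g (P y)) = c • P y := congrArg Subtype.val hev.apply_eq_smul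
    refine ⟨c, ?_⟩
    let E : Submodule ℂ V := LinearMap.ker (P.comp (ρ g) - c • LinearMap.id)
    have hE : ∀ w, w ∈ E ↔ P (ρ g w) = c • w := by
      intro w
      simp [E, LinearMap.mem_ker, sub_eq_zero]
    have hle := hcyc y hy0 E (fun h => by
      rw [hE, PP_comm ρ ψ hψ, ← hP, hy]
      simp)
    intro v
    exact (hE _).mp (hle ⟨v, rfl⟩)
  obtain ⟨⟨x, y, rfl⟩, hx⟩ := exists_ne (0 : LinearMap.range P)
  have hy0 : P y ≠ 0 := fun h => hx (Subtype.ext h)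
  have hle := hcyc y hy0 (Submodule.span ℂ {P y}) (fun g => by
    obtain ⟨c, hc⟩ := hscal g
    rw [hc]
    exact Submodule.smul_mem _ _ (Submodule.mem_span_singleton_self _))
  exact (Submodule.finrank_mono hle).trans (finrank_span_singleton hy0).le

theorem dim_formula [CharP F 2] (ρ : Representation ℂ (SLt F) V) [IsIrreducible ρ] :
    ∃ m ≤ 1, Module.finrank ℂ V =
      Module.finrank ℂ (invariants (ρ.comp (UU F).subtype : Representation ℂ (UU F) V)) +
        (Fintype.card F - 1) * m := by
  classical
  obtain ⟨ψ, hψ⟩ : ∃ ψ : AddChar F ℂ, ψ.IsPrimitive := by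
    obtain ⟨ψ, h⟩ := (AddChar.exists_apply_ne_zero (a := (1 : F))).mpr one_ne_zero
    refine ⟨ψ, AddChar.IsPrimitive.of_ne_one ?_⟩
    rintro rfl
    exact h rfl
  refine ⟨_, rank_PP ρ ψ hψ, ?_⟩
  have hU : Fintype.card F = Nat.card (UU F) := by
    rw [← Nat.card_congr (UUequiv F), Nat.card_eq_fintype_card]
  have hinv := invertibleOfNonzero (NeZero.ne (Nat.card (UU F) : ℂ))
  have hfin : Fintype (UU F) := Fintype.ofFinite _
  have h0 : LinearMap.trace ℂ V (PP ρ ψ 0) =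
      Module.finrank ℂ (invariants (ρ.comp (UU F).subtype : Representation ℂ (UU F) V)) := by
    rw [← card_inv_mul_sum_char_eq_finrank, ← hU, PP, map_smul, smul_eq_mul, map_sum]
    congr 1
    refine Fintype.sum_equiv (UUequiv F) _ _ fun x => ?_
    simp only [mul_zero, neg_zero, AddChar.map_zero_eq_one, one_smul]
    rfl
  have h1 : LinearMap.trace ℂ V (PP ρ ψ 1) = Module.finrank ℂ (LinearMap.range (PP ρ ψ 1)) := by
    apply LinearMap.IsProj.trace
    refine ⟨fun x => ⟨x, rfl⟩, ?_⟩
    rintro _ ⟨x, rfl⟩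
    exact PP_idem ρ ψ 1 x
  have h2 := congrArg (LinearMap.trace ℂ V) (PP_sum ρ ψ hψ)
  rw [map_sum, LinearMap.trace_one, ← Finset.add_sum_erase _ _ (Finset.mem_univ 0), h0] at h2
  rw [Finset.sum_congr rfl (fun a ha => (trace_PP ρ ψ a (Finset.ne_of_mem_erase ha)).trans h1),
    Finset.sum_const, Finset.card_erase_of_mem (Finset.mem_univ _), Finset.card_univ,
    nsmul_eq_mul] at h2
  exact_mod_cast h2.symm

theorem dim_le_of_inv [CharP F 2] (ρ : Representation ℂ (SLt F) V) [IsIrreducible ρ]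
    (h : Nontrivial (invariants (ρ.comp (UU F).subtype : Representation ℂ (UU F) V))) :
    Module.finrank ℂ V ≤ Fintype.card F + 1 := by
  classical
  set I := invariants (ρ.comp (UU F).subtype : Representation ℂ (UU F) V) with hI
  have hmem : ∀ v, v ∈ I ↔ ∀ x, ρ (uu x) v = v := by
    intro v
    constructor
    · intro hv x; exact hv ⟨uu x, x, rfl⟩
    · rintro hv ⟨_, x, rfl⟩; exact hv x
  obtain ⟨t, ht⟩ := IsCyclic.exists_monoid_generator (α := Fˣ)
  let T : Module.End ℂ I := (ρ (tt t)).restrict (p := I) (q := I) (fun v hv => by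
    rw [hmem] at hv ⊢
    intro x
    have : uu x * tt t = tt t * uu ((t ^ 2 : Fˣ)⁻¹ * x) := by
      rw [tt_uu]; congr 2; simp
    rw [← rho_mul, this, rho_mul, hv])
  obtain ⟨c, hc⟩ := Module.End.exists_eigenvalue T
  obtain ⟨⟨v, hv⟩, hev⟩ := hc.exists_hasEigenvector
  have hv0 : v ≠ 0 := fun h => hev.2 (Subtype.ext h)
  have hvt : ρ (tt t) v = c • v := congrArg Subtype.val hev.apply_eq_smul
  rw [hmem] at hv
  have hT : ∀ a : Fˣ, ∃ c : ℂ, ρ (tt a) v = c • v := by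
    intro a
    obtain ⟨k, rfl⟩ := ht a
    induction k with
    | zero => exact ⟨1, by simp [tt_one]⟩
    | succ k ih =>
      obtain ⟨c', hc'⟩ := ih
      refine ⟨c' * c, ?_⟩
      simp only at hc' ⊢
      rw [pow_succ, ← tt_mul, rho_mul, hvt, map_smul, hc', smul_smul, mul_comm]
  have hB : ∀ a b d h, ∃ c : ℂ, ρ (mk4 a b 0 d h) v = c • v := by
    intro a b d h
    have ha : a ≠ 0 := by rintro rfl; simp at h
    have : mk4 a b 0 d h = tt (Units.mk0 a ha) * uu (b / a) := by
      have hd : d = a⁻¹ := by field_simp; linear_combination h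
      subst hd
      unfold tt uu; rw [mk4_mul]; apply mk4_inj <;> simp
      field_simp
    rw [this, rho_mul, hv]
    exact hT _
  let s : Option F → V := fun o => match o with
    | none => v
    | some x => ρ (uu x * ww) v
  have hs : Submodule.span ℂ (Set.range s) = ⊤ := by
    rw [eq_top_iff, ← span_orbit ρ v hv0, Submodule.span_le]
    rintro _ ⟨g, rfl⟩
    obtain ⟨a, b, c, d, hd, rfl⟩ := mk4_surj g
    by_cases hc : c = 0
    · subst hc
      obtain ⟨z, hz⟩ := hB a b d hd
      simp only [hz]
      exact Submodule.smul_mem _ _ (Submodule.subset_span ⟨none, rfl⟩)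
    · have e : mk4 a b c d hd = uu (a / c) * ww * mk4 (-c) (-d) 0 (-c⁻¹) (by field_simp; ring) := by
        unfold uu ww; rw [mk4_mul, mk4_mul]; apply mk4_inj <;> field_simp
        · ring
        · linear_combination (-c) * hd
        · ring
        · ring
      obtain ⟨z, hz⟩ := hB (-c) (-d) (-c⁻¹) (by field_simp; ring)
      simp only [e]
      rw [rho_mul, hz, map_smul]
      exact Submodule.smul_mem _ _ (Submodule.subset_span ⟨some (a / c), rfl⟩)
  have := finrank_range_le_card (R := ℂ) s
  rw [Set.finrank, hs, finrank_top, Fintype.card_option] at this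
  exact this

theorem trivial_of_inv_top (ρ : Representation ℂ (SLt F) V) [hirr : IsIrreducible ρ]
    (h : invariants (ρ.comp (UU F).subtype : Representation ℂ (UU F) V) = ⊤) :
    (∀ g, ρ g = 1) ∧ Module.finrank ℂ V = 1 := by
  have h1 : ∀ g, ρ g = 1 := by
    have := normal_top (MonoidHom.ker ρ) (fun x => by
      rw [MonoidHom.mem_ker]
      refine LinearMap.ext fun v => ?_
      have : v ∈ invariants (ρ.comp (UU F).subtype : Representation ℂ (UU F) V) := by
        rw [h]; trivial
      exact this ⟨uu x, x, rfl⟩)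
    intro g
    rw [← MonoidHom.mem_ker, this]; trivial
  refine ⟨h1, ?_⟩
  have hnt := ((isIrr_iff ρ).mp hirr).1
  obtain ⟨v, hv⟩ := exists_ne (0 : V)
  have := span_orbit ρ v hv
  have h2 : (Set.range fun g => ρ g v) = {v} := by
    ext x
    simp [h1, eq_comm]
  rw [h2] at this
  rw [← finrank_top, ← this, finrank_span_singleton hv]

/-- main dimension dichotomy -/
theorem dim_cases [CharP F 2] (ρ : Representation ℂ (SLt F) V) [hirr : IsIrreducible ρ] :
    ((∀ g, ρ g = 1) ∧ Module.finrank ℂ V = 1) ∨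
    (invariants (ρ.comp (⊤ : Subgroup (SLt F)).subtype : Representation ℂ (⊤ : Subgroup (SLt F)) V) = ⊥ ∧
      ∃ k ≤ 2, Module.finrank ℂ (invariants (ρ.comp (UU F).subtype : Representation ℂ (UU F) V)) = k ∧
      Module.finrank ℂ V = k + (Fintype.card F - 1)) := by
  by_cases htriv : invariants (ρ.comp (UU F).subtype : Representation ℂ (UU F) V) = ⊤
  · left; exact trivial_of_inv_top ρ htriv
  right
  constructor
  · have hinv : ∀ g, ∀ v ∈ invariants (ρ.comp (⊤ : Subgroup (SLt F)).subtype),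
        ρ g v ∈ invariants (ρ.comp (⊤ : Subgroup (SLt F)).subtype) := by
      intro g v hv
      have : ρ g v = v := hv ⟨g, trivial⟩
      rw [this]; exact hv
    rcases ((isIrr_iff ρ).mp hirr).2 (invariants (ρ.comp (⊤ : Subgroup (SLt F)).subtype)) hinv with h | h
    · exact h
    · exfalso; apply htriv
      rw [Submodule.eq_top_iff']
      rintro v ⟨g, hg⟩
      have : v ∈ invariants (ρ.comp (⊤ : Subgroup (SLt F)).subtype) := by rw [h]; trivial
      exact this ⟨g, trivial⟩
  · obtain ⟨m, hm, hd⟩ := dim_formula ρ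
    have hm1 : m = 1 := by
      by_contra hne
      have : m = 0 := by omega
      subst this
      apply htriv
      apply Submodule.eq_top_of_finrank_eq
      omega
    subst hm1
    refine ⟨_, ?_, rfl, by omega⟩
    have hq := Fintype.card_pos (α := F)
    by_cases hn : Nontrivial (invariants (ρ.comp (UU F).subtype : Representation ℂ (UU F) V))
    · have := dim_le_of_inv ρ hn
      omega
    · rw [not_nontrivial_iff_subsingleton] at hn
      rw [Module.finrank_zero_of_subsingleton]
      omega

end SLdim

section SLcd
open Representation Matrix

theorem one_mem_cd (G : Type) [Group G] [Finite G] : 1 ∈ charDegrees G := by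
  rw [mem_cd_iff]
  refine ⟨ℂ, inferInstance, inferInstance, inferInstance, Representation.trivial ℂ G ℂ, ?_, by simp⟩
  rw [isIrr_iff]
  refine ⟨inferInstance, fun W _ => ?_⟩
  exact eq_bot_or_eq_top (α := Ideal ℂ) W

theorem arith_cd (r A B C : ℕ) (hr : 3 ≤ r)
    (h1 : 1 + B * (r + 1) + 2 * C * (r + 2) = r * (r + 2))
    (h2 : 1 + A * r ^ 2 + B * (r + 1) ^ 2 + C * (r + 2) ^ 2 = (r + 1) * r * (r + 2)) :
    A ≠ 0 ∧ B ≠ 0 ∧ C ≠ 0 := by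
  refine ⟨?_, ?_, ?_⟩
  · rintro rfl
    zify at *
    have : (r : ℤ) + C * (r + 2) * r = 0 := by linear_combination (r + 1 : ℤ) * h1 - h2
    have h3 : (0 : ℤ) ≤ C * (r + 2) * r := by positivity
    linarith
  · rintro rfl
    have : (r + 2) ∣ 1 := by
      refine (Nat.dvd_add_left (c := 2 * C * (r + 2)) (Dvd.intro_left _ rfl)).mp ?_
      rw [show 1 + 2 * C * (r + 2) = r * (r + 2) by linarith]
      exact Dvd.intro_left _ rfl
    have := Nat.le_of_dvd one_pos this
    omega
  · rintro rfl
    have : (r + 1) ∣ 2 := by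
      refine (Nat.dvd_add_left (c := B * (r + 1)) (Dvd.intro_left _ rfl)).mp ?_
      rw [show 2 + B * (r + 1) = (r + 1) * (r + 1) by linarith]
      exact Dvd.intro_left _ rfl
    have := Nat.le_of_dvd two_pos this
    omega

theorem cd_SL (F : Type) [Field F] [Fintype F] [DecidableEq F] [CharP F 2] (hq : 4 ≤ Fintype.card F) :
    (∀ d ∈ charDegrees (SLt F), d = 1 ∨ d = Fintype.card F - 1 ∨ d = Fintype.card F ∨
      d = Fintype.card F + 1) ∧ Fintype.card F - 1 ∈ charDegrees (SLt F) ∧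
      Fintype.card F ∈ charDegrees (SLt F) ∧ Fintype.card F + 1 ∈ charDegrees (SLt F) := by
  constructor
  · intro d hd
    rw [mem_cd_iff] at hd
    obtain ⟨V, _, _, _, ρ, hirr, rfl⟩ := hd
    rcases dim_cases ρ with ⟨_, h⟩ | ⟨_, k, hk, _, h⟩
    · left; exact h
    · omega
  obtain ⟨r, hr⟩ : ∃ r, Fintype.card F = r + 1 := ⟨Fintype.card F - 1, by omega⟩
  obtain ⟨n, d, ρ, hirr, hK⟩ := exists_regular (SLt F)
  have key : ∀ i, ∃ z a b c : ℕ,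
      d i * Module.finrank ℂ (invariants ((ρ i).comp (⊤ : Subgroup (SLt F)).subtype :
        Representation ℂ (⊤ : Subgroup (SLt F)) _)) = z ∧
      d i * Module.finrank ℂ (invariants ((ρ i).comp (UU F).subtype :
        Representation ℂ (UU F) _)) = z + b * (r + 1) + 2 * c * (r + 2) ∧
      d i * Module.finrank ℂ (invariants ((ρ i).comp (⊥ : Subgroup (SLt F)).subtype :
        Representation ℂ (⊥ : Subgroup (SLt F)) _)) =
          z + a * r ^ 2 + b * (r + 1) ^ 2 + c * (r + 2) ^ 2 ∧
      (a ≠ 0 → d i = r) ∧ (b ≠ 0 → d i = r + 1) ∧ (c ≠ 0 → d i = r + 2) := by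
    intro i
    have := hirr i
    have hbot : invariants ((ρ i).comp (⊥ : Subgroup (SLt F)).subtype :
        Representation ℂ (⊥ : Subgroup (SLt F)) _) = ⊤ := by
      rw [Submodule.eq_top_iff']
      rintro v ⟨g, hg⟩
      rw [Subgroup.mem_bot] at hg
      subst hg
      simp
    rw [hbot, finrank_top, Module.finrank_fin_fun]
    rcases dim_cases (ρ i) with ⟨h1, h⟩ | ⟨h0, k, hk, hk2, h⟩
    · rw [Module.finrank_fin_fun] at h
      have htop : ∀ K : Subgroup (SLt F), invariants ((ρ i).comp K.subtype :
          Representation ℂ K _) = ⊤ := by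
        intro K
        rw [Submodule.eq_top_iff']
        rintro v ⟨g, hg⟩
        simp [h1]
      refine ⟨1, 0, 0, 0, ?_⟩
      rw [htop, htop, finrank_top, Module.finrank_fin_fun, h]
      simp
    · rw [Module.finrank_fin_fun, hr, Nat.add_sub_cancel] at h
      rw [h0, hk2, finrank_bot, h]
      interval_cases k
      · exact ⟨0, 1, 0, 0, by simp, by simp, by ring, by simp, by simp, by simp⟩
      · exact ⟨0, 0, 1, 0, by simp, by ring, by ring, by simp, by intro; ring, by simp⟩
      · exact ⟨0, 0, 0, 1, by simp, by ring, by ring, by simp, by simp, by intro; ring⟩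
  choose z a b c hz hU hb ha' hb' hc' using key
  have e1 := hK ⊤
  have e2 := hK (UU F)
  have e3 := hK ⊥
  simp only [hz] at e1
  simp only [hU] at e2
  simp only [hb] at e3
  rw [Nat.card_congr (Subgroup.topEquiv (G := SLt F)).toEquiv] at e1
  rw [← Nat.card_congr (UUequiv F), Nat.card_eq_fintype_card, card_SLt, hr] at e2
  rw [Subgroup.card_bot, one_mul, card_SLt, hr] at e3
  have hpos : 0 < Nat.card (SLt F) := Nat.card_pos
  have f1 : ∑ i, z i = 1 := Nat.eq_of_mul_eq_mul_left hpos (by rw [e1, mul_one])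
  simp only [Nat.add_sub_cancel, mul_assoc] at e2
  have f2 := Nat.eq_of_mul_eq_mul_left (Nat.succ_pos r) e2
  simp only [Finset.sum_add_distrib, ← Finset.sum_mul, ← Finset.mul_sum, f1, Nat.add_sub_cancel] at f2 e3
  obtain ⟨hA, hB, hC⟩ := arith_cd r (∑ i, a i) (∑ i, b i) (∑ i, c i) (by omega)
    (by rw [mul_assoc 2]; linarith) (by linarith)
  have mem : ∀ i, d i ∈ charDegrees (SLt F) := by
    intro i
    rw [mem_cd_iff]
    exact ⟨_, inferInstance, inferInstance, inferInstance, ρ i, hirr i, by simp⟩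
  obtain ⟨i, _, hi⟩ := Finset.exists_ne_zero_of_sum_ne_zero hA
  obtain ⟨j, _, hj⟩ := Finset.exists_ne_zero_of_sum_ne_zero hB
  obtain ⟨k, _, hk⟩ := Finset.exists_ne_zero_of_sum_ne_zero hC
  rw [hr]
  refine ⟨?_, ?_, ?_⟩
  · have := mem i; rwa [ha' i hi] at this
  · have := mem j; rwa [hb' j hj] at this
  · have := mem k; rwa [hc' k hk] at this

theorem center_SL (F : Type) [Field F] [CharP F 2] :
    Subgroup.center (Matrix.SpecialLinearGroup (Fin 2) F) = ⊥ := by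
  rw [eq_bot_iff]
  intro A hA
  rw [Matrix.SpecialLinearGroup.mem_center_iff] at hA
  obtain ⟨x, hx, hA⟩ := hA
  have h1 : x = 1 := by
    have : (x - 1) ^ 2 = 0 := by
      rw [Fintype.card_fin] at hx
      have h2 : (2 : F) = 0 := CharTwo.two_eq_zero
      linear_combination hx - (x - 1) * h2
    exact sub_eq_zero.mp (pow_eq_zero_iff (two_ne_zero)|>.mp this)
  rw [Subgroup.mem_bot]
  apply Subtype.ext
  rw [← hA, h1]
  simp

theorem cd_PSL (f : ℕ) (hf : 2 ≤ f) :
    (∀ d ∈ charDegrees (PSL2 (GaloisField 2 f)), d = 1 ∨ d = 2 ^ f - 1 ∨ d = 2 ^ f ∨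
      d = 2 ^ f + 1) ∧ 2 ^ f - 1 ∈ charDegrees (PSL2 (GaloisField 2 f)) ∧
      2 ^ f ∈ charDegrees (PSL2 (GaloisField 2 f)) ∧
      2 ^ f + 1 ∈ charDegrees (PSL2 (GaloisField 2 f)) := by
  classical
  let _ : Fintype (GaloisField 2 f) := Fintype.ofFinite _
  have hc : Fintype.card (GaloisField 2 f) = 2 ^ f := by
    rw [← Nat.card_eq_fintype_card, GaloisField.card 2 f (by omega)]
  have h4 : 4 ≤ 2 ^ f := by
    calc 4 = 2 ^ 2 := by norm_num
      _ ≤ 2 ^ f := Nat.pow_le_pow_right (by norm_num) hf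
  have e : PSL2 (GaloisField 2 f) ≃* SLt (GaloisField 2 f) :=
    (QuotientGroup.quotientMulEquivOfEq (center_SL _)).trans QuotientGroup.quotientBot
  have := cd_SL (GaloisField 2 f) (by omega)
  rwa [hc, ← cd_mulEquiv e] at this

end SLcd

section GraphPart

theorem noK_aux (G : Type) [Group G] (h4 : (charGraph G).CliqueFree 4)
    (w x y z : ℕ) (pw : w.Prime) (px : x.Prime) (py : y.Prime) (pz : z.Prime)
    (hwx : w ≠ x) (hwy : w ≠ y) (hwz : w ≠ z) (hxy : x ≠ y) (hxz : x ≠ z) (hyz : y ≠ z)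
    (J : ℕ → ℕ → Prop) (hJ : ∀ p q, J p q ↔ ∃ n ∈ charDegrees G, p ∣ n ∧ q ∣ n)
    (jwx : J w x) (jwy : J w y) (jwz : J w z) (jxy : J x y) (jxz : J x z) (jyz : J y z) : False := by
  classical
  have adj : ∀ p q : charPrimes G, (p : ℕ) ≠ q → J p q → (charGraph G).Adj p q := by
    rintro ⟨p, pp⟩ ⟨q, pq⟩ hne hj
    obtain ⟨n, hn, h1, h2⟩ := (hJ _ _).mp hj
    exact ⟨hne, n, hn, Nat.Coprime.mul_dvd_of_dvd_of_dvd
      ((Nat.coprime_primes pp.1 pq.1).mpr hne) h1 h2⟩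
  have mem : ∀ p q, p.Prime → J p q → p ∈ charPrimes G := by
    intro p q pp hj
    obtain ⟨n, hn, h1, _⟩ := (hJ _ _).mp hj
    exact ⟨pp, n, hn, h1⟩
  have mw := mem w x pw jwx
  have mx := mem x y px jxy
  have my := mem y z py jyz
  have mz : z ∈ charPrimes G := by
    obtain ⟨n, hn, _, h1⟩ := (hJ _ _).mp jyz
    exact ⟨pz, n, hn, h1⟩
  have a1 := adj ⟨w, mw⟩ ⟨x, mx⟩ hwx jwx
  have a2 := adj ⟨w, mw⟩ ⟨y, my⟩ hwy jwy
  have a3 := adj ⟨w, mw⟩ ⟨z, mz⟩ hwz jwz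
  have a4 := adj ⟨x, mx⟩ ⟨y, my⟩ hxy jxy
  have a5 := adj ⟨x, mx⟩ ⟨z, mz⟩ hxz jxz
  have a6 := adj ⟨y, my⟩ ⟨z, mz⟩ hyz jyz
  refine h4 {⟨w, mw⟩, ⟨x, mx⟩, ⟨y, my⟩, ⟨z, mz⟩} ⟨?_, ?_⟩
  · simp [SimpleGraph.isClique_insert, a1, a2, a3, a4, a5, a6]
  · rw [Finset.card_insert_of_notMem, Finset.card_insert_of_notMem,
      Finset.card_insert_of_notMem, Finset.card_singleton] <;> simp <;> tauto

set_option linter.unusedSimpArgs false in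
set_option maxHeartbeats 4000000 in
theorem graph_main (G R : Type) [Group G] [Group R] (q1 q q2 : ℕ)
    (h4 : (charGraph G).CliqueFree 4)
    (h7 : Nat.card ↥(charPrimes G) = 7)
    (hcd : ∀ d, d ∈ charDegrees G ↔ ∃ n, (n = 1 ∨ n = q1 ∨ n = q ∨ n = q2) ∧
      ∃ m ∈ charDegrees R, d = n * m)
    (h1 : 1 ∈ charDegrees R)
    (a b c d : ℕ) (hab : a ≠ b) (hac : a ≠ c) (had : a ≠ d) (hbc : b ≠ c) (hbd : b ≠ d)
    (hcd' : c ≠ d) (ha2 : a ≠ 2) (hb2 : b ≠ 2) (hc2 : c ≠ 2) (hd2 : d ≠ 2)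
    (pa : a.Prime) (pb : b.Prime) (pc : c.Prime) (pd : d.Prime)
    (hq1 : ∀ p, p.Prime → (p ∣ q1 ↔ p = a ∨ p = b))
    (hq : ∀ p, p.Prime → (p ∣ q ↔ p = 2))
    (hq2 : ∀ p, p.Prime → (p ∣ q2 ↔ p = c ∨ p = d)) :
    Nat.card ↥(charPrimes R) = 2 ∧ charGraph R = ⊥ ∧
    Nonempty (charGraph G ≃g
      graphJoin (((⊤ : SimpleGraph (Fin 2)) ⊕g (⊤ : SimpleGraph (Fin 1))) ⊕g (⊤ : SimpleGraph (Fin 2))) (⊥ : SimpleGraph (Fin 2))) := by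
  classical
  have p2 := Nat.prime_two
  obtain ⟨J, hJ⟩ : ∃ J : ℕ → ℕ → Prop, ∀ p q, J p q ↔ ∃ n ∈ charDegrees G, p ∣ n ∧ q ∣ n :=
    ⟨_, fun _ _ => Iff.rfl⟩
  have Jsymm : ∀ p q, J p q → J q p := by
    intro p q h
    obtain ⟨n, hn, x, y⟩ := (hJ _ _).mp h
    exact (hJ _ _).mpr ⟨n, hn, y, x⟩
  have mkJ : ∀ n m x y, (n = 1 ∨ n = q1 ∨ n = q ∨ n = q2) → m ∈ charDegrees R →
      x ∣ n * m → y ∣ n * m → J x y := by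
    intro n m x y hn hm hx hy
    exact (hJ _ _).mpr ⟨n * m, (hcd _).mpr ⟨n, hn, m, hm, rfl⟩, hx, hy⟩
  have daq : a ∣ q1 := (hq1 a pa).mpr (Or.inl rfl)
  have dbq : b ∣ q1 := (hq1 b pb).mpr (Or.inr rfl)
  have dcq : c ∣ q2 := (hq2 c pc).mpr (Or.inl rfl)
  have ddq : d ∣ q2 := (hq2 d pd).mpr (Or.inr rfl)
  have d2q : 2 ∣ q := (hq 2 p2).mpr rfl
  -- edges between primes of S and primes of R
  have JSR : ∀ n p r, (n = 1 ∨ n = q1 ∨ n = q ∨ n = q2) → p ∣ n → r ∈ charPrimes R → J p r := by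
    rintro n p r hn hp ⟨_, m, hm, hr⟩
    exact mkJ n m p r hn hm (Dvd.dvd.mul_right hp m) (Dvd.dvd.mul_left hr n)
  have JS : ∀ n p r, (n = 1 ∨ n = q1 ∨ n = q ∨ n = q2) → p ∣ n → r ∣ n → J p r := by
    intro n p r hn hp hr
    exact mkJ n 1 p r hn h1 (by simpa using hp) (by simpa using hr)
  have noX : ∀ n u v w r, (n = 1 ∨ n = q1 ∨ n = q ∨ n = q2) → u.Prime → v.Prime → u ∣ n → v ∣ n →
      w ∈ charPrimes R → r ∈ charPrimes R → u ≠ v → u ≠ w → u ≠ r → v ≠ w → v ≠ r → w ≠ r →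
      ¬ J w r := by
    intro n u v w r hn pu pv hu hv hw hr e1 e2 e3 e4 e5 e6 hj
    exact noK_aux G h4 u v w r pu pv hw.1 hr.1 e1 e2 e3 e4 e5 e6 J hJ (JS n u v hn hu hv)
      (JSR n u w hn hu hw) (JSR n u r hn hu hr) (JSR n v w hn hv hw) (JSR n v r hn hv hr) hj
  have hR : ∀ p, p ∈ charPrimes R → p ∈ charPrimes G := by
    rintro p ⟨pp, m, hm, h⟩
    exact ⟨pp, m, (hcd m).mpr ⟨1, Or.inl rfl, m, hm, (one_mul m).symm⟩, h⟩
  have hS : ∀ n p, (n = 1 ∨ n = q1 ∨ n = q ∨ n = q2) → p.Prime → p ∣ n → p ∈ charPrimes G := by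
    intro n p hn pp h
    exact ⟨pp, n, (hcd n).mpr ⟨n, hn, 1, h1, (mul_one n).symm⟩, h⟩
  let P5 : Finset ℕ := {a, b, 2, c, d}
  have hP5 : ∀ p, p ∈ P5 ↔ p = a ∨ p = b ∨ p = 2 ∨ p = c ∨ p = d := by intro p; simp [P5]
  have hcard : P5.card = 5 := by
    simp only [P5]
    rw [Finset.card_insert_of_notMem, Finset.card_insert_of_notMem,
      Finset.card_insert_of_notMem, Finset.card_insert_of_notMem, Finset.card_singleton] <;>
    simp <;> grind
  have ma := hS q1 a (by simp) pa daq
  have mb := hS q1 b (by simp) pb dbq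
  have m2 := hS q 2 (by simp) p2 d2q
  have mc := hS q2 c (by simp) pc dcq
  have md := hS q2 d (by simp) pd ddq
  have hsub : (P5 : Set ℕ) ⊆ charPrimes G := by
    intro p hp
    rw [Finset.mem_coe, hP5] at hp
    rcases hp with rfl | rfl | rfl | rfl | rfl <;> assumption
  have h7' : (charPrimes G).ncard = 7 := h7
  have hdiff : (charPrimes G \ P5).ncard = 2 := by
    rw [Set.ncard_sdiff hsub (Finset.finite_toSet _), h7', Set.ncard_coe_finset, hcard]
  obtain ⟨r, s, hrs, hd⟩ := Set.ncard_eq_two.mp hdiff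
  have hmemG : ∀ p, p ∈ charPrimes G → p ∈ charPrimes R ∨ p ∈ P5 := by
    rintro p ⟨pp, D, hD, hpD⟩
    obtain ⟨n, hn, m, hm, rfl⟩ := (hcd D).mp hD
    rcases (Nat.Prime.dvd_mul pp).mp hpD with h | h
    · right
      rw [hP5]
      rcases hn with rfl | rfl | rfl | rfl
      · exact absurd (Nat.dvd_one.mp h) pp.one_lt.ne'
      · have := (hq1 p pp).mp h; tauto
      · have := (hq p pp).mp h; tauto
      · have := (hq2 p pp).mp h; tauto
    · left; exact ⟨pp, m, hm, h⟩
  have hout : ∀ x, x ∈ ({r, s} : Set ℕ) → x ∈ charPrimes R ∧ x ∈ charPrimes G ∧ x ∉ P5 := by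
    intro x hx
    rw [← hd] at hx
    have h2 : x ∉ P5 := fun h => hx.2 h
    exact ⟨(hmemG x hx.1).resolve_right h2, hx.1, h2⟩
  obtain ⟨hrR, hrG, hr5⟩ := hout r (by simp)
  obtain ⟨hsR, hsG, hs5⟩ := hout s (by simp)
  rw [hP5] at hr5 hs5
  push Not at hr5 hs5
  obtain ⟨ra, rb, r2, rc, rd⟩ := hr5
  obtain ⟨sa, sb, s2, sc, sd⟩ := hs5
  have nR : ∀ p, p ∈ P5 → p ∉ charPrimes R := by
    intro p hp hpR
    rw [hP5] at hp
    rcases hp with rfl | rfl | rfl | rfl | rfl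
    · exact noX q2 c d p r (by simp) pc pd dcq ddq hpR hrR hcd' hac.symm rc.symm had.symm rd.symm
        ra.symm (JSR q1 p r (by simp) daq hrR)
    · exact noX q2 c d p r (by simp) pc pd dcq ddq hpR hrR hcd' hbc.symm rc.symm hbd.symm rd.symm
        rb.symm (JSR q1 p r (by simp) dbq hrR)
    · exact noX q1 a b 2 r (by simp) pa pb daq dbq hpR hrR hab ha2 ra.symm hb2 rb.symm
        r2.symm (JSR q 2 r (by simp) d2q hrR)
    · exact noX q1 a b p r (by simp) pa pb daq dbq hpR hrR hab hac ra.symm hbc rb.symm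
        rc.symm (JSR q2 p r (by simp) dcq hrR)
    · exact noX q1 a b p r (by simp) pa pb daq dbq hpR hrR hab had ra.symm hbd rb.symm
        rd.symm (JSR q2 p r (by simp) ddq hrR)
  have hReq : charPrimes R = {r, s} := by
    ext p
    constructor
    · intro hp
      rw [← hd]
      exact ⟨hR p hp, fun h => nR p h hp⟩
    · intro hp; exact (hout p hp).1
  have nrs : ¬ J r s := noX q1 a b r s (by simp) pa pb daq dbq hrR hsR hab ra.symm sa.symm rb.symm
    sb.symm hrs
  have nSS : ∀ x y, x ∈ P5 → y ∈ P5 → x.Prime → y.Prime → J x y →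
      ((x = a ∨ x = b) ∧ (y = a ∨ y = b)) ∨ (x = 2 ∧ y = 2) ∨
      ((x = c ∨ x = d) ∧ (y = c ∨ y = d)) := by
    intro x y hx hy px py hj
    obtain ⟨D, hD, hxD, hyD⟩ := (hJ _ _).mp hj
    obtain ⟨n, hn, m, hm, rfl⟩ := (hcd D).mp hD
    have hx' : x ∣ n := ((Nat.Prime.dvd_mul px).mp hxD).resolve_right
      (fun h => nR x hx ⟨px, m, hm, h⟩)
    have hy' : y ∣ n := ((Nat.Prime.dvd_mul py).mp hyD).resolve_right
      (fun h => nR y hy ⟨py, m, hm, h⟩)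
    rcases hn with rfl | rfl | rfl | rfl
    · exact absurd (Nat.dvd_one.mp hx') px.one_lt.ne'
    · left; exact ⟨(hq1 x px).mp hx', (hq1 y py).mp hy'⟩
    · right; left; exact ⟨(hq x px).mp hx', (hq y py).mp hy'⟩
    · right; right; exact ⟨(hq2 x px).mp hx', (hq2 y py).mp hy'⟩
  refine ⟨?_, ?_, ?_⟩
  · rw [hReq]
    exact Set.ncard_pair hrs
  · ext ⟨x, hx⟩ ⟨y, hy⟩
    simp only [SimpleGraph.bot_adj, iff_false]
    rintro ⟨hne, n, hn, hdvd⟩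
    have hj : J x y := mkJ 1 n x y (by simp) hn (by simpa using (Dvd.intro _ rfl).trans hdvd)
      (by simpa using (Dvd.intro_left _ rfl).trans hdvd)
    rw [hReq] at hx hy
    rcases hx with rfl | rfl <;> rcases hy with rfl | rfl
    · exact hne rfl
    · exact nrs hj
    · exact nrs (Jsymm _ _ hj)
    · exact hne rfl
  · have hAdj : ∀ (p q : ℕ) (hp : p ∈ charPrimes G) (hq : q ∈ charPrimes G),
        (charGraph G).Adj ⟨p, hp⟩ ⟨q, hq⟩ ↔ p ≠ q ∧ J p q := by
      intro p q hp hq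
      constructor
      · rintro ⟨hne, n, hn, hdvd⟩
        exact ⟨hne, (hJ _ _).mpr ⟨n, hn, (Dvd.intro _ rfl).trans hdvd,
          (Dvd.intro_left _ rfl).trans hdvd⟩⟩
      · rintro ⟨hne, hj⟩
        obtain ⟨n, hn, h1, h2⟩ := (hJ _ _).mp hj
        exact ⟨hne, n, hn, Nat.Coprime.mul_dvd_of_dvd_of_dvd
          ((Nat.coprime_primes hp.1 hq.1).mpr hne) h1 h2⟩
    let g0 : ((Fin 2 ⊕ Fin 1) ⊕ Fin 2) ⊕ Fin 2 → ℕ :=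
      Sum.elim (Sum.elim (Sum.elim ![a, b] ![2]) ![c, d]) ![r, s]
    have hg0 : ∀ i, g0 i ∈ charPrimes G := by
      rintro (((i | i) | i) | i) <;> fin_cases i <;> simp [g0] <;> assumption
    have hinj : Function.Injective g0 := by
      rintro (((i | i) | i) | i) (((j | j) | j) | j) h <;> fin_cases i <;> fin_cases j <;>
        simp [g0] at h ⊢ <;> grind
    have hbij : Function.Bijective (fun i => (⟨g0 i, hg0 i⟩ : charPrimes G)) := by
      constructor
      · intro i j h
        exact hinj (congrArg Subtype.val h)
      · rintro ⟨p, hp⟩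
        have : p ∈ P5 ∨ p ∈ ({r, s} : Set ℕ) := by
          by_cases h : p ∈ P5
          · exact Or.inl h
          · right; rw [← hd]; exact ⟨hp, h⟩
        rw [hP5] at this
        rcases this with (rfl | rfl | rfl | rfl | rfl) | (rfl | rfl)
        · exact ⟨Sum.inl (Sum.inl (Sum.inl 0)), rfl⟩
        · exact ⟨Sum.inl (Sum.inl (Sum.inl 1)), rfl⟩
        · exact ⟨Sum.inl (Sum.inl (Sum.inr 0)), rfl⟩
        · exact ⟨Sum.inl (Sum.inr 0), rfl⟩
        · exact ⟨Sum.inl (Sum.inr 1), rfl⟩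
        · exact ⟨Sum.inr 0, rfl⟩
        · exact ⟨Sum.inr 1, rfl⟩
    have jab := JS q1 a b (by simp) daq dbq
    have jcd := JS q2 c d (by simp) dcq ddq
    have jba := Jsymm _ _ jab
    have jdc := Jsymm _ _ jcd
    have nsr : ¬ J s r := fun h => nrs (Jsymm _ _ h)
    have jS : ∀ x, x ∈ P5 → J x r ∧ J x s ∧ J r x ∧ J s x := by
      intro x hx
      suffices h : J x r ∧ J x s from ⟨h.1, h.2, Jsymm _ _ h.1, Jsymm _ _ h.2⟩
      rw [hP5] at hx
      rcases hx with rfl | rfl | rfl | rfl | rfl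
      · exact ⟨JSR q1 _ _ (by simp) daq hrR, JSR q1 _ _ (by simp) daq hsR⟩
      · exact ⟨JSR q1 _ _ (by simp) dbq hrR, JSR q1 _ _ (by simp) dbq hsR⟩
      · exact ⟨JSR q _ _ (by simp) d2q hrR, JSR q _ _ (by simp) d2q hsR⟩
      · exact ⟨JSR q2 _ _ (by simp) dcq hrR, JSR q2 _ _ (by simp) dcq hsR⟩
      · exact ⟨JSR q2 _ _ (by simp) ddq hrR, JSR q2 _ _ (by simp) ddq hsR⟩
    obtain ⟨ja1, ja2, ja3, ja4⟩ := jS a (by simp [P5])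
    obtain ⟨jb1, jb2, jb3, jb4⟩ := jS b (by simp [P5])
    obtain ⟨j21, j22, j23, j24⟩ := jS 2 (by simp [P5])
    obtain ⟨jc1, jc2, jc3, jc4⟩ := jS c (by simp [P5])
    obtain ⟨jd1, jd2, jd3, jd4⟩ := jS d (by simp [P5])
    have nac : ¬ J a c := fun h => by
      have := nSS a c (by simp [P5]) (by simp [P5]) pa pc h; grind
    have nad : ¬ J a d := fun h => by
      have := nSS a d (by simp [P5]) (by simp [P5]) pa pd h; grind
    have na2 : ¬ J a 2 := fun h => by
      have := nSS a 2 (by simp [P5]) (by simp [P5]) pa p2 h; grind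
    have nbc : ¬ J b c := fun h => by
      have := nSS b c (by simp [P5]) (by simp [P5]) pb pc h; grind
    have nbd : ¬ J b d := fun h => by
      have := nSS b d (by simp [P5]) (by simp [P5]) pb pd h; grind
    have nb2 : ¬ J b 2 := fun h => by
      have := nSS b 2 (by simp [P5]) (by simp [P5]) pb p2 h; grind
    have nc2 : ¬ J c 2 := fun h => by
      have := nSS c 2 (by simp [P5]) (by simp [P5]) pc p2 h; grind
    have nd2 : ¬ J d 2 := fun h => by
      have := nSS d 2 (by simp [P5]) (by simp [P5]) pd p2 h; grind
    have nca : ¬ J c a := fun h => nac (Jsymm _ _ h)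
    have nda : ¬ J d a := fun h => nad (Jsymm _ _ h)
    have n2a : ¬ J 2 a := fun h => na2 (Jsymm _ _ h)
    have ncb : ¬ J c b := fun h => nbc (Jsymm _ _ h)
    have ndb : ¬ J d b := fun h => nbd (Jsymm _ _ h)
    have n2b : ¬ J 2 b := fun h => nb2 (Jsymm _ _ h)
    have n2c : ¬ J 2 c := fun h => nc2 (Jsymm _ _ h)
    have n2d : ¬ J 2 d := fun h => nd2 (Jsymm _ _ h)
    refine ⟨RelIso.symm ⟨Equiv.ofBijective _ hbij, ?_⟩⟩
    intro i j
    simp only [Equiv.ofBijective_apply]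
    rw [hAdj]
    clear hbij hinj hg0 hAdj nSS noX JSR JS mkJ hJ Jsymm
    rcases i with (((i | i) | i) | i) <;> rcases j with (((j | j) | j) | j) <;>
      fin_cases i <;> fin_cases j <;>
      simp [g0, graphJoin, hab, hab.symm, hcd', hcd'.symm, hrs, ra, rb, r2, rc, rd, sa, sb, s2, sc, sd,
        ra.symm, rb.symm, r2.symm, rc.symm, rd.symm, sa.symm, sb.symm, s2.symm, sc.symm, sd.symm,
        jab, jba, jcd, jdc, nrs, nsr, ja1, ja2, ja3, ja4, jb1, jb2, jb3, jb4, j21, j22, j23, j24,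
        jc1, jc2, jc3, jc4, jd1, jd2, jd3, jd4, nac, nad, na2, nbc, nbd, nb2, nc2, nd2, nca, nda,
        n2a, ncb, ndb, n2b, n2c, n2d]

end GraphPart

theorem stmt2 (G : Type) [Group G] [Finite G]
    (h4 : (charGraph G).CliqueFree 4)
    (h7 : Nat.card ↥(charPrimes G) = 7)
    (f : ℕ) (hf : 2 ≤ f)
    (hiso : Nonempty (G ≃* PSL2 (GaloisField 2 f) × ↥(solvableRadical G)))
    (hm : (2 ^ f - 1).primeFactors.card = 2)
    (hp : (2 ^ f + 1).primeFactors.card = 2) :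
    Nat.card ↥(charPrimes ↥(solvableRadical G)) = 2 ∧
    charGraph ↥(solvableRadical G) = ⊥ ∧
    Nonempty (charGraph G ≃g
      graphJoin (((⊤ : SimpleGraph (Fin 2)) ⊕g (⊤ : SimpleGraph (Fin 1))) ⊕g (⊤ : SimpleGraph (Fin 2))) (⊥ : SimpleGraph (Fin 2))) := by
  obtain ⟨e⟩ := hiso
  obtain ⟨a, b, hab, hA⟩ := Finset.card_eq_two.mp hm
  obtain ⟨c, d, hcd, hC⟩ := Finset.card_eq_two.mp hp
  obtain ⟨hS, hS1, hS2, hS3⟩ := cd_PSL f hf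
  have hpos : 4 ≤ 2 ^ f := by
    calc 4 = 2 ^ 2 := by norm_num
      _ ≤ 2 ^ f := Nat.pow_le_pow_right (by norm_num) hf
  have heven : 2 ∣ 2 ^ f := dvd_pow_self 2 (by omega)
  have hq1 : ∀ p, p.Prime → (p ∣ 2 ^ f - 1 ↔ p = a ∨ p = b) := by
    intro p pp
    have : p ∈ (2 ^ f - 1).primeFactors ↔ p = a ∨ p = b := by rw [hA]; simp
    rw [← this, Nat.mem_primeFactors]
    exact ⟨fun h => ⟨pp, h, by omega⟩, fun h => h.2.1⟩
  have hq2 : ∀ p, p.Prime → (p ∣ 2 ^ f + 1 ↔ p = c ∨ p = d) := by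
    intro p pp
    have : p ∈ (2 ^ f + 1).primeFactors ↔ p = c ∨ p = d := by rw [hC]; simp
    rw [← this, Nat.mem_primeFactors]
    exact ⟨fun h => ⟨pp, h, by omega⟩, fun h => h.2.1⟩
  have hq : ∀ p, p.Prime → (p ∣ 2 ^ f ↔ p = 2) := by
    intro p pp
    constructor
    · intro h; exact (Nat.prime_dvd_prime_iff_eq pp Nat.prime_two).mp (pp.dvd_of_dvd_pow h)
    · rintro rfl; exact heven
  have fa : a.Prime ∧ a ∣ 2 ^ f - 1 := by
    have : a ∈ (2 ^ f - 1).primeFactors := by rw [hA]; simp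
    exact ⟨Nat.prime_of_mem_primeFactors this, Nat.dvd_of_mem_primeFactors this⟩
  have fb : b.Prime ∧ b ∣ 2 ^ f - 1 := by
    have : b ∈ (2 ^ f - 1).primeFactors := by rw [hA]; simp
    exact ⟨Nat.prime_of_mem_primeFactors this, Nat.dvd_of_mem_primeFactors this⟩
  have fc : c.Prime ∧ c ∣ 2 ^ f + 1 := by
    have : c ∈ (2 ^ f + 1).primeFactors := by rw [hC]; simp
    exact ⟨Nat.prime_of_mem_primeFactors this, Nat.dvd_of_mem_primeFactors this⟩
  have fd : d.Prime ∧ d ∣ 2 ^ f + 1 := by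
    have : d ∈ (2 ^ f + 1).primeFactors := by rw [hC]; simp
    exact ⟨Nat.prime_of_mem_primeFactors this, Nat.dvd_of_mem_primeFactors this⟩
  have n1 : ∀ p, p ∣ 2 ^ f - 1 → p ≠ 2 := by
    rintro p h rfl; omega
  have n2 : ∀ p, p ∣ 2 ^ f + 1 → p ≠ 2 := by
    rintro p h rfl; omega
  have n3 : ∀ p p', p.Prime → p ∣ 2 ^ f - 1 → p' ∣ 2 ^ f + 1 → p ≠ p' := by
    rintro p _ pp h h' rfl
    have h2 : p ∣ 2 := by
      have := Nat.dvd_sub h' h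
      rwa [show 2 ^ f + 1 - (2 ^ f - 1) = 2 by omega] at this
    exact n1 p h ((Nat.prime_dvd_prime_iff_eq pp Nat.prime_two).mp h2)
  refine graph_main G (solvableRadical G) (2 ^ f - 1) (2 ^ f) (2 ^ f + 1) h4 h7 ?_
    (one_mem_cd _) a b c d hab (n3 _ _ fa.1 fa.2 fc.2) (n3 _ _ fa.1 fa.2 fd.2)
    (n3 _ _ fb.1 fb.2 fc.2) (n3 _ _ fb.1 fb.2 fd.2) hcd (n1 _ fa.2) (n1 _ fb.2) (n2 _ fc.2)
    (n2 _ fd.2) fa.1 fb.1 fc.1 fd.1 hq1 hq hq2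
  have hfS : Finite (PSL2 (GaloisField 2 f)) := inferInstance
  intro D
  rw [cd_mulEquiv e]
  constructor
  · intro hD
    obtain ⟨n, hn, m, hm, rfl⟩ := cd_prod_of_mem hD
    exact ⟨n, hS n hn, m, hm, rfl⟩
  · rintro ⟨n, hn, m, hm, rfl⟩
    refine cd_prod_mul ?_ hm
    rcases hn with rfl | rfl | rfl | rfl
    · exact one_mem_cd _
    · exact hS1
    · exact hS2
    · exact hS3
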